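/- Fix a real number p with 0 < p < 1 and consider the positive-step die with face values 1 and 2 having probabilities p and 1−p respectively; let E(n) and V(n) be the expectation and variance of the duration until the running total first reaches ≥ n. Then V(n) − ( p(1−p)·n/(2−p)³ − (1−p)(p²+p−1)/(2−p)⁴ ) tends to 0 as n → ∞. -/

import Mathlib

/-- The sum of the first `j` steps of the word `w` (face values given by `v`). -/
def prefSumN {s k : ℕ} (v : Fin s → ℕ) (w : Fin k → Fin s) (j : ℕ) : ℕ :=
  ∑ i ∈ Finset.univ.filter (fun i : Fin k => (i : ℕ) < j), v (w i)

/-- The first-passage probability `P_n(k)`: the probability that the running total of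
rolls of the die (face values `v`, probabilities `p`) first reaches `≥ n` at exactly
roll `k`. -/
noncomputable def firstPassage {s : ℕ} (v : Fin s → ℕ) (p : Fin s → ℝ) (n k : ℕ) : ℝ :=
  ∑ w ∈ Finset.univ.filter (fun w : Fin k → Fin s =>
      n ≤ prefSumN v w k ∧ ∀ j : ℕ, j < k → prefSumN v w j < n),
    ∏ i : Fin k, p (w i)

/-- The expected duration `E(n) = Σ_{k=1}^n k · P_n(k)` until first reaching `≥ n`. -/
noncomputable def expDur {s : ℕ} (v : Fin s → ℕ) (p : Fin s → ℝ) (n : ℕ) : ℝ :=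
  ∑ k ∈ Finset.Icc 1 n, (k : ℝ) * firstPassage v p n k

/-- The variance `V(n) = Σ_{k=1}^n k² · P_n(k) − E(n)²` of the duration. -/
noncomputable def varDur {s : ℕ} (v : Fin s → ℕ) (p : Fin s → ℝ) (n : ℕ) : ℝ :=
  (∑ k ∈ Finset.Icc 1 n, (k : ℝ) ^ 2 * firstPassage v p n k) - (expDur v p n) ^ 2

theorem prefSumN_zero {s k : ℕ} (v : Fin s → ℕ) (w : Fin k → Fin s) :
    prefSumN v w 0 = 0 := by
  simp [prefSumN]

theorem prefSumN_cons_succ {s k : ℕ} (v : Fin s → ℕ) (i : Fin s) (w : Fin k → Fin s) (j : ℕ) :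
    prefSumN v (Fin.cons i w : Fin (k + 1) → Fin s) (j + 1) = v i + prefSumN v w j := by
  simp [prefSumN, Finset.sum_filter, Fin.sum_univ_succ]

theorem firstPassage_zero_zero {s : ℕ} (v : Fin s → ℕ) (p : Fin s → ℝ) :
    firstPassage v p 0 0 = 1 := by
  simp [firstPassage]

theorem firstPassage_zero_succ {s : ℕ} (v : Fin s → ℕ) (p : Fin s → ℝ) (k : ℕ) :
    firstPassage v p 0 (k + 1) = 0 := by
  rw [firstPassage, Finset.filter_false_of_mem, Finset.sum_empty]
  rintro w - ⟨-, h⟩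
  exact Nat.not_lt_zero _ (h 0 k.succ_pos)

theorem firstPassage_succ_zero {s : ℕ} (v : Fin s → ℕ) (p : Fin s → ℝ) (n : ℕ) :
    firstPassage v p (n + 1) 0 = 0 := by
  simp [firstPassage, prefSumN]

/-- Conditioning on the first roll. -/
theorem firstPassage_succ_succ {s : ℕ} (v : Fin s → ℕ) (p : Fin s → ℝ) (n k : ℕ) :
    firstPassage v p (n + 1) (k + 1) = ∑ i, p i * firstPassage v p (n + 1 - v i) k := by
  have hcond (i : Fin s) (w : Fin k → Fin s) :
      (n + 1 ≤ prefSumN v (Fin.cons i w : Fin (k + 1) → Fin s) (k + 1) ∧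
        ∀ j : ℕ, j < k + 1 → prefSumN v (Fin.cons i w : Fin (k + 1) → Fin s) j < n + 1) ↔
      (n + 1 - v i ≤ prefSumN v w k ∧ ∀ j : ℕ, j < k → prefSumN v w j < n + 1 - v i) := by
    rw [prefSumN_cons_succ]
    refine and_congr (by omega) ⟨fun h j hj => ?_, fun h j hj => ?_⟩
    · have := h (j + 1) (by omega)
      rw [prefSumN_cons_succ] at this
      omega
    · cases j with
      | zero => rw [prefSumN_zero]; omega
      | succ j =>
        have := h j (by omega)
        rw [prefSumN_cons_succ]
        omega
  simp only [firstPassage, Finset.sum_filter, Finset.mul_sum]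
  rw [← (Fin.consEquiv (fun _ : Fin (k + 1) => Fin s)).sum_comp, Fintype.sum_prod_type]
  refine Finset.sum_congr rfl fun i _ => Finset.sum_congr rfl fun w _ => ?_
  rw [show Fin.consEquiv (fun _ : Fin (k + 1) => Fin s) (i, w) = Fin.cons i w from rfl]
  simp only [hcond, Fin.prod_univ_succ, Fin.cons_zero, Fin.cons_succ, mul_ite, mul_zero]

theorem firstPassage_eq_zero_of_lt {s : ℕ} {v : Fin s → ℕ} (hv : ∀ i, 0 < v i) (p : Fin s → ℝ)
    {n k : ℕ} (h : n < k) : firstPassage v p n k = 0 := by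
  induction k generalizing n with
  | zero => omega
  | succ k ih =>
    cases n with
    | zero => exact firstPassage_zero_succ v p k
    | succ n =>
      rw [firstPassage_succ_succ]
      refine Finset.sum_eq_zero fun i _ => ?_
      have := hv i
      rw [ih (by omega), mul_zero]

/-- The expectation of `f` of the duration until the running total first reaches `≥ n`. -/
noncomputable def durExp {s : ℕ} (v : Fin s → ℕ) (p : Fin s → ℝ) (f : ℕ → ℝ) (n : ℕ) : ℝ :=
  ∑ k ∈ Finset.range (n + 1), f k * firstPassage v p n k

theorem durExp_eq_sum_range {s : ℕ} {v : Fin s → ℕ} (hv : ∀ i, 0 < v i) (p : Fin s → ℝ)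
    (f : ℕ → ℝ) {n N : ℕ} (h : n < N) :
    durExp v p f n = ∑ k ∈ Finset.range N, f k * firstPassage v p n k := by
  refine Finset.sum_subset (Finset.range_subset_range.2 h) fun k _ hk => ?_
  rw [Finset.mem_range, not_lt] at hk
  rw [firstPassage_eq_zero_of_lt hv p (by omega), mul_zero]

theorem durExp_eq_sum_Icc {s : ℕ} (v : Fin s → ℕ) (p : Fin s → ℝ) {f : ℕ → ℝ} (hf : f 0 = 0)
    (n : ℕ) : durExp v p f n = ∑ k ∈ Finset.Icc 1 n, f k * firstPassage v p n k := by
  symm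
  refine Finset.sum_subset (fun k hk => ?_) fun k hk hk' => ?_
  · simp only [Finset.mem_Icc, Finset.mem_range] at hk ⊢
    omega
  · simp only [Finset.mem_Icc, Finset.mem_range] at hk hk'
    obtain rfl : k = 0 := by omega
    rw [hf, zero_mul]

theorem durExp_zero {s : ℕ} (v : Fin s → ℕ) (p : Fin s → ℝ) (f : ℕ → ℝ) :
    durExp v p f 0 = f 0 := by
  simp [durExp, firstPassage_zero_zero]

theorem durExp_succ {s : ℕ} {v : Fin s → ℕ} (hv : ∀ i, 0 < v i) (p : Fin s → ℝ)
    (f : ℕ → ℝ) (n : ℕ) :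
    durExp v p f (n + 1) = ∑ i, p i * durExp v p (fun k => f (k + 1)) (n + 1 - v i) := by
  have h (i : Fin s) : n + 1 - v i < n + 1 := by
    have := hv i
    omega
  simp only [fun i => durExp_eq_sum_range hv p (fun k => f (k + 1)) (h i)]
  rw [durExp, Finset.sum_range_succ', firstPassage_succ_zero, mul_zero, add_zero]
  simp only [firstPassage_succ_succ, Finset.mul_sum]
  rw [Finset.sum_comm]
  exact Finset.sum_congr rfl fun i _ => Finset.sum_congr rfl fun k _ => by ring

theorem durExp_add {s : ℕ} (v : Fin s → ℕ) (p : Fin s → ℝ) (f g : ℕ → ℝ) (n : ℕ) :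
    durExp v p (fun k => f k + g k) n = durExp v p f n + durExp v p g n := by
  simp only [durExp, add_mul, Finset.sum_add_distrib]

theorem durExp_const_mul {s : ℕ} (v : Fin s → ℕ) (p : Fin s → ℝ) (c : ℝ) (f : ℕ → ℝ) (n : ℕ) :
    durExp v p (fun k => c * f k) n = c * durExp v p f n := by
  simp only [durExp, mul_assoc, Finset.mul_sum]

theorem durExp_one {s : ℕ} {v : Fin s → ℕ} (hv : ∀ i, 0 < v i) {p : Fin s → ℝ}
    (hp : ∑ i, p i = 1) (n : ℕ) : durExp v p (fun _ => 1) n = 1 := by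
  induction n using Nat.strong_induction_on with
  | _ n ih =>
    cases n with
    | zero => exact durExp_zero v p _
    | succ n =>
      rw [durExp_succ hv]
      refine (Finset.sum_congr rfl fun i _ => ?_).trans hp
      have := hv i
      rw [ih _ (by omega), mul_one]

theorem expDur_eq_durExp {s : ℕ} (v : Fin s → ℕ) (p : Fin s → ℝ) (n : ℕ) :
    expDur v p n = durExp v p (fun k => (k : ℝ)) n :=
  (durExp_eq_sum_Icc v p Nat.cast_zero n).symm

theorem varDur_eq_durExp {s : ℕ} (v : Fin s → ℕ) (p : Fin s → ℝ) (n : ℕ) :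
    varDur v p n = durExp v p (fun k => (k : ℝ) ^ 2) n - durExp v p (fun k => (k : ℝ)) n ^ 2 := by
  rw [varDur, expDur_eq_durExp, durExp_eq_sum_Icc v p (f := fun k => (k : ℝ) ^ 2) (by simp)]

theorem durExp_id_succ {s : ℕ} {v : Fin s → ℕ} (hv : ∀ i, 0 < v i) {p : Fin s → ℝ}
    (hp : ∑ i, p i = 1) (n : ℕ) :
    durExp v p (fun k => (k : ℝ)) (n + 1) =
      1 + ∑ i, p i * durExp v p (fun k => (k : ℝ)) (n + 1 - v i) := by
  rw [durExp_succ hv]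
  simp only [Nat.cast_add, Nat.cast_one, durExp_add v p (fun k => (k : ℝ)) (fun _ => 1),
    durExp_one hv hp, mul_add, mul_one, Finset.sum_add_distrib, hp]
  ring

theorem durExp_sq_succ {s : ℕ} {v : Fin s → ℕ} (hv : ∀ i, 0 < v i) {p : Fin s → ℝ}
    (hp : ∑ i, p i = 1) (n : ℕ) :
    durExp v p (fun k => (k : ℝ) ^ 2) (n + 1) =
      2 * durExp v p (fun k => (k : ℝ)) (n + 1) - 1 +
        ∑ i, p i * durExp v p (fun k => (k : ℝ) ^ 2) (n + 1 - v i) := by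
  have hsq (m : ℕ) : durExp v p (fun k => ((k + 1 : ℕ) : ℝ) ^ 2) m =
      durExp v p (fun k => (k : ℝ) ^ 2) m + 2 * durExp v p (fun k => (k : ℝ)) m + 1 := by
    rw [← durExp_const_mul, ← durExp_add, ← durExp_one hv hp m, ← durExp_add]
    congr 1
    ext k
    push_cast
    ring
  rw [durExp_succ hv, durExp_id_succ hv hp]
  simp only [hsq, mul_add, mul_one, Finset.sum_add_distrib, hp, Finset.mul_sum]
  simp only [mul_left_comm (2 : ℝ)]
  ring

/-- A solution of `u (n + 2) = a (n + 2) + b u (n + 1) + c u n` is determined by its first two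
values. -/
theorem eq_of_second_order_recurrence {u w a : ℕ → ℝ} {b c : ℝ}
    (hu : ∀ n, u (n + 2) = a n + (b * u (n + 1) + c * u n))
    (hw : ∀ n, w (n + 2) = a n + (b * w (n + 1) + c * w n))
    (h0 : u 0 = w 0) (h1 : u 1 = w 1) (n : ℕ) : u n = w n := by
  induction n using Nat.twoStepInduction with
  | zero => exact h0
  | one => exact h1
  | more n ih ih' => rw [hu, hw, ih, ih']

theorem coin_faces_pos (i : Fin 2) : 0 < (![1, 2] : Fin 2 → ℕ) i := by
  fin_cases i <;> simp

theorem coin_weights_sum (p : ℝ) : ∑ i, (![p, 1 - p] : Fin 2 → ℝ) i = 1 := by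
  simp

theorem durExp_id_coin {p : ℝ} (hp : p ≠ 2) (n : ℕ) :
    durExp ![1, 2] ![p, 1 - p] (fun k => (k : ℝ)) n =
      n / (2 - p) + (1 - p) / (2 - p) ^ 2 * (1 - (p - 1) ^ n) := by
  have h2 : 2 - p ≠ 0 := sub_ne_zero.2 hp.symm
  refine eq_of_second_order_recurrence (a := fun _ => 1) (b := p) (c := 1 - p)
    (u := durExp ![1, 2] ![p, 1 - p] (fun k => (k : ℝ)))
    (w := fun n : ℕ => (n : ℝ) / (2 - p) + (1 - p) / (2 - p) ^ 2 * (1 - (p - 1) ^ n))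
    (fun n => ?_) (fun n => ?_) ?_ ?_ n
  · rw [durExp_id_succ coin_faces_pos (coin_weights_sum p)]
    simp
  · push_cast
    field_simp
    ring
  · simp [durExp_zero]
  · rw [durExp_id_succ coin_faces_pos (coin_weights_sum p) 0]
    simp [durExp_zero]
    field_simp
    ring

theorem durExp_sq_coin {p : ℝ} (hp : p ≠ 2) (n : ℕ) :
    durExp ![1, 2] ![p, 1 - p] (fun k => (k : ℝ) ^ 2) n =
      (n : ℝ) ^ 2 / (2 - p) ^ 2 + (1 - p) * (2 + p) * n / (2 - p) ^ 3 +
        2 * (1 - p) * (p - 1) / (2 - p) ^ 3 * (n * (p - 1) ^ n) -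
        (1 - p) * (p ^ 2 + 2 * p - 2) / (2 - p) ^ 4 * (1 - (p - 1) ^ n) := by
  have h2 : 2 - p ≠ 0 := sub_ne_zero.2 hp.symm
  refine eq_of_second_order_recurrence (b := p) (c := 1 - p)
    (a := fun n : ℕ => 2 * (((n + 2 : ℕ) : ℝ) / (2 - p) +
      (1 - p) / (2 - p) ^ 2 * (1 - (p - 1) ^ (n + 2))) - 1)
    (u := durExp ![1, 2] ![p, 1 - p] (fun k => (k : ℝ) ^ 2))
    (w := fun n : ℕ => (n : ℝ) ^ 2 / (2 - p) ^ 2 + (1 - p) * (2 + p) * n / (2 - p) ^ 3 +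
        2 * (1 - p) * (p - 1) / (2 - p) ^ 3 * (n * (p - 1) ^ n) -
        (1 - p) * (p ^ 2 + 2 * p - 2) / (2 - p) ^ 4 * (1 - (p - 1) ^ n))
    (fun n => ?_) (fun n => ?_) ?_ ?_ n
  · rw [durExp_sq_succ coin_faces_pos (coin_weights_sum p), durExp_id_coin hp]
    simp [add_assoc, one_add_one_eq_two]
  · push_cast
    field_simp
    ring
  · simp [durExp_zero]
  · rw [durExp_sq_succ coin_faces_pos (coin_weights_sum p) 0, durExp_id_coin hp]
    simp [durExp_zero]
    field_simp
    ring

/-- For the die with faces 1 and 2 of probabilities p and 1−p, the variance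
`V(n)` of the duration satisfies
`V(n) − (p(1−p)n/(2−p)³ − (1−p)(p²+p−1)/(2−p)⁴) → 0` as `n → ∞`. -/
theorem variance_duration_loaded_coin (p : ℝ) (hp0 : 0 < p) (hp1 : p < 1) :
    Filter.Tendsto
      (fun n : ℕ => varDur ![1, 2] ![p, 1 - p] n -
        (p * (1 - p) * (n : ℝ) / (2 - p) ^ 3 - (1 - p) * (p ^ 2 + p - 1) / (2 - p) ^ 4))
      Filter.atTop (nhds 0) := by
  have hp : p ≠ 2 := by linarith
  have h2 : 2 - p ≠ 0 := sub_ne_zero.2 hp.symm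
  have habs : |p - 1| < 1 := abs_lt.2 ⟨by linarith, by linarith⟩
  have hpow := tendsto_pow_atTop_nhds_zero_of_abs_lt_one habs
  have hmul := tendsto_self_mul_const_pow_of_abs_lt_one habs
  have hlim := ((hmul.const_mul (2 * p * (1 - p) / (2 - p) ^ 3)).add
    (hpow.const_mul ((2 * (1 - p) ^ 2 + (1 - p) * (p ^ 2 + 2 * p - 2)) / (2 - p) ^ 4))).sub
    ((hpow.pow 2).const_mul ((1 - p) ^ 2 / (2 - p) ^ 4))
  norm_num at hlim
  refine hlim.congr fun n => ?_
  rw [varDur_eq_durExp, durExp_sq_coin hp, durExp_id_coin hp]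
  generalize (p - 1) ^ n = y
  field_simp
  ring
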